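/- Let F: 𝒴 → ℝ≥0 be a function on a set 𝒴 of 'subsurfaces', and let L₀ ≤ L. Suppose the number of Y ∈ 𝒴 with F(Y) ∈ [L₀, L) is at most p + p·∑_{Y ∈ 𝒴} {{F(Y)}}_L for some constant p ≥ 1, where {{t}}_L = t if t ≥ L and 0 otherwise. Then ∑_{Y} {{F(Y)}}_{L₀} ≤ (pL + 1)·∑_{Y} {{F(Y)}}_L + pL. -/

import Mathlib

/-- comparing thresholded sums. If the number of `Y` with `F(Y) ∈ [L₀, L)` is
at most `p + p·∑_Y {{F(Y)}}_L`, then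
`∑_Y {{F(Y)}}_{L₀} ≤ (pL+1)·∑_Y {{F(Y)}}_L + pL`. -/
theorem stmt8 {ι : Type*} [Fintype ι] (F : ι → ℝ) (hF : ∀ Y, 0 ≤ F Y)
    (L₀ L : ℝ) (hL₀ : 0 < L₀) (hL : L₀ ≤ L)
    (p : ℝ) (hp : 1 ≤ p)
    (hcount : ((Finset.univ.filter (fun Y : ι => L₀ ≤ F Y ∧ F Y < L)).card : ℝ) ≤
      p + p * ∑ Y, (if L ≤ F Y then F Y else 0)) :
    ∑ Y, (if L₀ ≤ F Y then F Y else 0) ≤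
      (p * L + 1) * ∑ Y, (if L ≤ F Y then F Y else 0) + p * L := by
  have h_sum : ∑ Y, (if L₀ ≤ F Y then F Y else 0) ≤
      ∑ Y, ((if L ≤ F Y then F Y else 0) + if L₀ ≤ F Y ∧ F Y < L then L else 0) := by
    refine Finset.sum_le_sum fun Y _ => ?_
    split_ifs <;> grind
  rw [Finset.sum_add_distrib, ← Finset.sum_filter (fun Y => L₀ ≤ F Y ∧ F Y < L),
    Finset.sum_const, nsmul_eq_mul] at h_sum
  have h_mul := mul_le_mul_of_nonneg_right hcount (hL₀.le.trans hL)
  linarith
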